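/- There exists a universal constant c > 0 with the following property. For any L, B ≥ 1, any 0 < ε ≤ 1 with LB/ε ≥ 1, any dimensions n, d, and any fixed L-Lipschitz function f: ℝⁿ → ℝ, if m ≥ (LB/ε)^{cL²B²/ε²}, then the Rademacher complexity of the class {x ↦ f(Wx) : W ∈ ℝ^{n×d}, ‖W‖_F ≤ B} on m inputs from {x ∈ ℝ^d : ‖x‖ ≤ 1} is at most ε. -/

import Mathlib

noncomputable section

open scoped BigOperators

/-- Euclidean norm of a vector in `ℝ^n`. -/
def euclNorm {n : ℕ} (v : Fin n → ℝ) : ℝ := Real.sqrt (∑ i, (v i) ^ 2)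

/-- Frobenius norm of a matrix. -/
def frobNorm {n d : ℕ} (M : Matrix (Fin n) (Fin d) ℝ) : ℝ :=
  Real.sqrt (∑ i, ∑ j, (M i j) ^ 2)

/-- Rademacher complexity of a class `F` of real-valued functions on the fixed
inputs `x 0, …, x (m-1)`. -/
def radComplexity {X : Type*} {m : ℕ} (F : Set (X → ℝ)) (x : Fin m → X) : ℝ :=
  (∑ e : Fin m → Bool,
      sSup ((fun f => (∑ i, (if e i then (1 : ℝ) else -1) * f (x i)) / (m : ℝ)) '' F)) /
    2 ^ m

/-- The sign `±1` encoded by a Boolean. -/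
def boolSign (b : Bool) : ℝ := if b then 1 else -1

@[simp] lemma boolSign_true : boolSign true = 1 := by simp [boolSign]

@[simp] lemma boolSign_false : boolSign false = -1 := by simp [boolSign]

@[simp] lemma boolSign_not (b : Bool) : boolSign (!b) = -boolSign b := by
  cases b <;> simp

@[simp] lemma boolSign_mul_self (b : Bool) : boolSign b * boolSign b = 1 := by
  cases b <;> simp

/-- Flip the `i`-th coordinate of a sign vector. -/
def flipAt {m : ℕ} (i : Fin m) (e : Fin m → Bool) : Fin m → Bool :=
  Function.update e i (!e i)

@[simp] lemma flipAt_same {m : ℕ} (i : Fin m) (e : Fin m → Bool) : flipAt i e i = !e i := by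
  simp [flipAt]

lemma flipAt_of_ne {m : ℕ} {i l : Fin m} (h : l ≠ i) (e : Fin m → Bool) :
    flipAt i e l = e l := by
  simp [flipAt, h]

@[simp] lemma flipAt_flipAt {m : ℕ} (i : Fin m) (e : Fin m → Bool) :
    flipAt i (flipAt i e) = e := by
  simp [flipAt]

lemma sum_flipAt {m : ℕ} (i : Fin m) (F : (Fin m → Bool) → ℝ) :
    ∑ e, F (flipAt i e) = ∑ e, F e :=
  Equiv.sum_comp (Function.Involutive.toPerm (flipAt i) (flipAt_flipAt i)) F

lemma card_signs (m : ℕ) : ((Finset.univ : Finset (Fin m → Bool)).card : ℝ) = 2 ^ m := by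
  simp

/-- The unnormalised Rademacher average of the family `φ` of vectors is at most `C`. The supremum
is expressed through selections of a parameter for every sign vector. -/
def RadLE {Θ : Type*} {m : ℕ} (φ : Θ → Fin m → ℝ) (C : ℝ) : Prop :=
  ∀ θ : (Fin m → Bool) → Θ, ∑ e, ∑ i, boolSign (e i) * φ (θ e) i ≤ 2 ^ m * C

namespace RadLE

variable {Θ : Type*} {m : ℕ} {φ ψ : Θ → Fin m → ℝ} {C D : ℝ}

lemma mono (h : RadLE φ C) (hCD : C ≤ D) : RadLE φ D := fun θ =>
  (h θ).trans (mul_le_mul_of_nonneg_left hCD (by positivity))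

lemma add (h : RadLE φ C) (h' : RadLE ψ D) : RadLE (fun θ i => φ θ i + ψ θ i) (C + D) := by
  intro θ
  simp only [mul_add, Finset.sum_add_distrib]
  exact add_le_add (h θ) (h' θ)

lemma const_mul (h : RadLE φ C) {a : ℝ} (ha : 0 ≤ a) : RadLE (fun θ i => a * φ θ i) (a * C) := by
  intro θ
  have := mul_le_mul_of_nonneg_left (h θ) ha
  simp only [Finset.mul_sum] at this
  calc _ = _ := Finset.sum_congr rfl fun e _ => Finset.sum_congr rfl fun i _ => by ring
    _ ≤ _ := this
    _ = _ := by ring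

lemma neg (h : RadLE φ C) : RadLE (fun θ i => -φ θ i) C := by
  intro θ
  let σ : (Fin m → Bool) ≃ (Fin m → Bool) :=
    Function.Involutive.toPerm (fun e i => !e i) (fun e => by simp)
  rw [← Equiv.sum_comp σ]
  refine le_of_eq_of_le ?_ (h fun e => θ (σ e))
  refine Finset.sum_congr rfl fun e _ => Finset.sum_congr rfl fun i _ => ?_
  have : σ e i = !e i := rfl
  simp [this]

lemma sum {ι : Type*} (s : Finset ι) {φ : ι → Θ → Fin m → ℝ} {C : ι → ℝ}
    (h : ∀ j ∈ s, RadLE (φ j) (C j)) : RadLE (fun θ i => ∑ j ∈ s, φ j θ i) (∑ j ∈ s, C j) := by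
  classical
  induction s using Finset.induction_on with
  | empty => intro θ; simp
  | insert a s ha ih =>
    simp only [Finset.sum_insert ha]
    exact (h a (by simp)).add (ih fun j hj => h j (by simp [hj]))

lemma of_abs_sub_le (h : RadLE φ C) {δ : ℝ} (hδ : ∀ θ i, |ψ θ i - φ θ i| ≤ δ) :
    RadLE ψ (C + m * δ) := by
  intro θ
  have key : ∀ e : Fin m → Bool, ∑ i, boolSign (e i) * ψ (θ e) i
      ≤ ∑ i, boolSign (e i) * φ (θ e) i + m * δ := by
    intro e
    have : (m : ℝ) * δ = ∑ _i : Fin m, δ := by simp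
    rw [this, ← Finset.sum_add_distrib]
    refine Finset.sum_le_sum fun i _ => ?_
    have := abs_le.1 (hδ (θ e) i)
    cases e i <;> simp <;> linarith
  calc _ ≤ ∑ e, (∑ i, boolSign (e i) * φ (θ e) i + m * δ) := Finset.sum_le_sum fun e _ => key e
    _ = ∑ e, ∑ i, boolSign (e i) * φ (θ e) i + 2 ^ m * (m * δ) := by
      rw [Finset.sum_add_distrib, Finset.sum_const, nsmul_eq_mul, card_signs]
    _ ≤ _ := by rw [mul_add]; exact add_le_add (h θ) le_rfl

lemma sum_eq_add_erase (a : Fin m → ℝ) (i : Fin m) :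
    ∑ l, a l = a i + ∑ l ∈ Finset.univ.erase i, a l :=
  (Finset.add_sum_erase _ _ (Finset.mem_univ i)).symm

/-- Contraction in a single coordinate. -/
lemma contract_coord (h : RadLE φ C) (i : Fin m) (hne : ∀ θ l, l ≠ i → ψ θ l = φ θ l)
    (hi : ∀ θ θ', |ψ θ i - ψ θ' i| ≤ |φ θ i - φ θ' i|) : RadLE ψ C := by
  classical
  intro θ
  let θ' : (Fin m → Bool) → Θ := fun e =>
    if 0 ≤ boolSign (e i) * (φ (θ e) i - φ (θ (flipAt i e)) i) then θ e else θ (flipAt i e)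
  refine le_trans ?_ (h θ')
  have two : ∀ F : (Fin m → Bool) → ℝ, ∑ e, (F e + F (flipAt i e)) = 2 * ∑ e, F e := by
    intro F
    rw [Finset.sum_add_distrib, sum_flipAt, two_mul]
  refine le_of_mul_le_mul_left ?_ (two_pos : (0 : ℝ) < 2)
  rw [← two, ← two]
  refine Finset.sum_le_sum fun e _ => ?_
  simp only [sum_eq_add_erase _ i, flipAt_same, boolSign_not]
  have hH : ∀ t : Θ, ∑ l ∈ Finset.univ.erase i, boolSign (e l) * ψ t l
      = ∑ l ∈ Finset.univ.erase i, boolSign (e l) * φ t l := fun t =>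
    Finset.sum_congr rfl fun l hl => by rw [hne t l (Finset.ne_of_mem_erase hl)]
  have hF : ∀ (χ : Θ → Fin m → ℝ) (t : Θ),
      ∑ l ∈ Finset.univ.erase i, boolSign (flipAt i e l) * χ t l
      = ∑ l ∈ Finset.univ.erase i, boolSign (e l) * χ t l := fun χ t =>
    Finset.sum_congr rfl fun l hl => by rw [flipAt_of_ne (Finset.ne_of_mem_erase hl)]
  simp only [hF, hH]
  have hb := hi (θ e) (θ (flipAt i e))
  by_cases hc : 0 ≤ boolSign (e i) * (φ (θ e) i - φ (θ (flipAt i e)) i)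
  · have h1 : θ' e = θ e := by simp only [θ', if_pos hc]
    have h2 : θ' (flipAt i e) = θ (flipAt i e) := by
      simp only [θ', flipAt_same, flipAt_flipAt, boolSign_not]
      rw [if_pos (by linarith)]
    rw [h1, h2]
    cases he : e i <;> simp only [he, boolSign_true, boolSign_false] at hc ⊢
    · rw [abs_of_nonpos (a := φ _ _ - _) (by linarith)] at hb
      linarith [abs_le.1 hb]
    · rw [abs_of_nonneg (a := φ _ _ - _) (by linarith)] at hb
      linarith [abs_le.1 hb]
  · have h1 : θ' e = θ (flipAt i e) := by simp only [θ', if_neg hc]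
    have h2 : θ' (flipAt i e) = θ e := by
      simp only [θ', flipAt_same, flipAt_flipAt, boolSign_not]
      rw [if_neg (by intro h; exact hc (by linarith))]
    rw [h1, h2]
    cases he : e i <;> simp only [he, boolSign_true, boolSign_false] at hc ⊢
    · rw [abs_of_nonneg (a := φ _ _ - _) (by linarith)] at hb
      linarith [abs_le.1 hb]
    · rw [abs_of_nonpos (a := φ _ _ - _) (by linarith)] at hb
      linarith [abs_le.1 hb]

/-- The contraction principle. -/
lemma contract (h : RadLE φ C) (hi : ∀ θ θ' i, |ψ θ i - ψ θ' i| ≤ |φ θ i - φ θ' i|) :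
    RadLE ψ C := by
  classical
  have key : ∀ s : Finset (Fin m),
      RadLE (fun θ l => if l ∈ s then φ θ l else ψ θ l) C → RadLE ψ C := by
    intro s
    induction s using Finset.induction_on with
    | empty => intro h; simpa using h
    | insert a s ha ih =>
      intro h
      refine ih (h.contract_coord a ?_ ?_)
      · intro θ l hl
        simp [hl]
      · intro θ θ'
        simpa [ha] using hi θ θ' a
  exact key Finset.univ (by simpa using h)

lemma max (h : RadLE φ C) (h' : RadLE ψ D) : RadLE (fun θ i => φ θ i ⊔ ψ θ i) (C + D) := by
  have habs : RadLE (fun θ i => |φ θ i + -ψ θ i|) (C + D) :=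
    (h.add h'.neg).contract fun θ θ' i => abs_abs_sub_abs_le_abs_sub _ _
  have := ((h.add h').add habs).const_mul (a := 1 / 2) (by norm_num)
  intro θ
  refine le_of_eq_of_le ?_ ((this θ).trans_eq (by ring))
  refine Finset.sum_congr rfl fun e _ => Finset.sum_congr rfl fun i _ => ?_
  congr 1
  dsimp only
  rcases le_total (φ (θ e) i) (ψ (θ e) i) with hle | hle
  · rw [max_eq_right hle, abs_of_nonpos (by linarith)]
    ring
  · rw [max_eq_left hle, abs_of_nonneg (by linarith)]
    ring

lemma sup' {ι : Type*} {s : Finset ι} (hs : s.Nonempty) {φ : ι → Θ → Fin m → ℝ}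
    (h : ∀ j ∈ s, RadLE (φ j) C) :
    RadLE (fun θ i => s.sup' hs fun j => φ j θ i) (s.card * C) := by
  induction hs using Finset.Nonempty.cons_induction with
  | singleton a => simpa using h a (by simp)
  | cons a s ha hs ih =>
    have := (h a (by simp)).max (ih fun j hj => h j (by simp [hj]))
    simp only [Finset.sup'_cons hs, Finset.card_cons]
    exact this.mono (by push_cast; linarith)

end RadLE

lemma sum_boolSign_mul {m : ℕ} {i l : Fin m} (h : i ≠ l) :
    ∑ e : Fin m → Bool, boolSign (e i) * boolSign (e l) = 0 := by
  have := sum_flipAt i fun e => boolSign (e i) * boolSign (e l)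
  simp only [flipAt_same, flipAt_of_ne h.symm, boolSign_not, neg_mul,
    Finset.sum_neg_distrib] at this
  linarith

section InnerProduct

variable {E : Type*} [NormedAddCommGroup E] [InnerProductSpace ℝ E]

lemma sum_norm_sq_signed_sum {m : ℕ} (x : Fin m → E) :
    ∑ e : Fin m → Bool, ‖∑ i, boolSign (e i) • x i‖ ^ 2 = 2 ^ m * ∑ i, ‖x i‖ ^ 2 := by
  have h1 : ∀ e : Fin m → Bool, ‖∑ i, boolSign (e i) • x i‖ ^ 2
      = ∑ i, ∑ l, boolSign (e i) * boolSign (e l) * inner ℝ (x i) (x l) := by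
    intro e
    rw [← real_inner_self_eq_norm_sq, sum_inner]
    refine Finset.sum_congr rfl fun i _ => ?_
    rw [inner_sum]
    refine Finset.sum_congr rfl fun l _ => ?_
    rw [real_inner_smul_left, real_inner_smul_right]
    ring
  simp only [h1]
  rw [Finset.sum_comm, Finset.mul_sum]
  refine Finset.sum_congr rfl fun i _ => ?_
  rw [Finset.sum_comm, Finset.sum_eq_single i]
  · simp
  · intro l _ hl
    rw [← Finset.sum_mul, sum_boolSign_mul hl.symm, zero_mul]
  · simp

lemma RadLE.linear {Θ : Type*} {m : ℕ} {x : Fin m → E} (hx : ∀ i, ‖x i‖ ≤ 1) {w : Θ → E} {A : ℝ}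
    (hA : 0 ≤ A) (hw : ∀ θ, ‖w θ‖ ≤ A) :
    RadLE (fun θ i => inner ℝ (w θ) (x i)) (A * √m) := by
  intro θ
  have hsq : (∑ e : Fin m → Bool, ‖∑ i, boolSign (e i) • x i‖) ^ 2 ≤ (2 ^ m * √m) ^ 2 := by
    refine sq_sum_le_card_mul_sum_sq.trans ?_
    rw [card_signs, sum_norm_sq_signed_sum, mul_pow, Real.sq_sqrt (Nat.cast_nonneg m), sq,
      mul_assoc]
    have : ∑ i, ‖x i‖ ^ 2 ≤ m := by
      calc ∑ i, ‖x i‖ ^ 2 ≤ ∑ _i : Fin m, (1 : ℝ) :=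
            Finset.sum_le_sum fun i _ => pow_le_one₀ (norm_nonneg _) (hx i)
        _ = m := by simp
    gcongr
  have hS := abs_le_of_sq_le_sq hsq (by positivity)
  calc _ = ∑ e : Fin m → Bool, inner ℝ (w (θ e)) (∑ i, boolSign (e i) • x i) := by
        refine Finset.sum_congr rfl fun e _ => ?_
        rw [inner_sum]
        exact Finset.sum_congr rfl fun i _ => (real_inner_smul_right _ _ _).symm
    _ ≤ ∑ e : Fin m → Bool, A * ‖∑ i, boolSign (e i) • x i‖ :=
        Finset.sum_le_sum fun e _ => (real_inner_le_norm _ _).trans (by gcongr; exact hw _)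
    _ = A * ∑ e : Fin m → Bool, ‖∑ i, boolSign (e i) • x i‖ := by rw [Finset.mul_sum]
    _ ≤ A * (2 ^ m * √m) := by gcongr; exact (le_abs_self _).trans hS
    _ = _ := by ring

lemma RadLE.const {Θ : Type*} {m : ℕ} {a : Θ → ℝ} {A : ℝ} (hA : 0 ≤ A) (ha : ∀ θ, |a θ| ≤ A) :
    RadLE (fun θ (_ : Fin m) => a θ) (A * √m) := by
  simpa using RadLE.linear (m := m) (x := fun _ => (1 : ℝ)) (by simp) hA ha

lemma RadLE.add_const {Θ : Type*} {m : ℕ} {φ : Θ → Fin m → ℝ} {C : ℝ} (h : RadLE φ C) (b : ℝ) :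
    RadLE (fun θ i => φ θ i + b) C := by
  have hb : RadLE (fun (_ : Θ) (_ : Fin m) => b) 0 := by
    intro θ
    rw [Finset.sum_comm]
    refine (Finset.sum_eq_zero fun i _ => ?_).trans_le (by simp)
    have := sum_flipAt i fun e => boolSign (e i) * b
    simp only [flipAt_same, boolSign_not, neg_mul, Finset.sum_neg_distrib] at this
    linarith
  simpa using h.add hb

end InnerProduct

section Reduction

variable {E F : Type*} [NormedAddCommGroup E] [InnerProductSpace ℝ E]
  [NormedAddCommGroup F] [InnerProductSpace ℝ F]

/-- The Hilbert–Schmidt norm of `T` is at most `B`, expressed on finite orthonormal families. -/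
def HSNormLE (T : E →ₗ[ℝ] F) (B : ℝ) : Prop :=
  ∀ (k : ℕ) (v : Fin k → E), Orthonormal ℝ v → ∑ j, ‖T (v j)‖ ^ 2 ≤ B ^ 2

namespace HSNormLE

variable {T : E →ₗ[ℝ] F} {B : ℝ}

lemma norm_apply_le (hT : HSNormLE T B) (hB : 0 ≤ B) (u : E) : ‖T u‖ ≤ B * ‖u‖ := by
  rcases eq_or_ne u 0 with rfl | hu
  · simp
  have hn : 0 < ‖u‖ := norm_pos_iff.2 hu
  have h := hT 1 (fun _ => ‖u‖⁻¹ • u) (by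
    rw [orthonormal_iff_ite]
    intro i j
    rw [Subsingleton.elim i j, if_pos rfl, real_inner_self_eq_norm_sq, norm_smul, norm_inv,
      norm_norm, inv_mul_cancel₀ hn.ne', one_pow])
  rw [Fin.sum_univ_one, map_smul, norm_smul, norm_inv, norm_norm] at h
  have h' := abs_le_of_sq_le_sq h hB
  rw [abs_of_nonneg (by positivity), inv_mul_le_iff₀ hn] at h'
  linarith

/-- Up to an operator-norm error `τ`, `T` factors through at most `K` orthonormal directions. -/
lemma exists_orthonormal (hT : HSNormLE T B) {τ : ℝ} (hτ : 0 < τ) {K : ℕ}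
    (hK : ∀ k : ℕ, k * τ ^ 2 ≤ B ^ 2 → k ≤ K) :
    ∃ k ≤ K, ∃ v : Fin k → E, Orthonormal ℝ v ∧
      ∀ u, (∀ j, inner ℝ (v j) u = 0) → ‖T u‖ ≤ τ * ‖u‖ := by
  classical
  let P : ℕ → Prop := fun k => ∃ v : Fin k → E, Orthonormal ℝ v ∧ ∀ j, τ < ‖T (v j)‖
  have hP : ∀ k, P k → k ≤ K := by
    rintro k ⟨v, hv, hj⟩
    refine hK k (le_trans ?_ (hT k v hv))
    calc (k : ℝ) * τ ^ 2 = ∑ _j : Fin k, τ ^ 2 := by simp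
      _ ≤ _ := Finset.sum_le_sum fun j _ => by gcongr; exact (hj j).le
  have hP0 : P 0 := ⟨Fin.elim0, ⟨fun j => j.elim0, fun j => j.elim0⟩, fun j => j.elim0⟩
  obtain ⟨v, hv, hj⟩ : P (Nat.findGreatest P K) := Nat.findGreatest_spec (Nat.zero_le K) hP0
  refine ⟨_, Nat.findGreatest_le K, v, hv, fun u hu => ?_⟩
  by_contra! hlt
  have hu0 : u ≠ 0 := by
    rintro rfl
    simp at hlt
  have hn : 0 < ‖u‖ := norm_pos_iff.2 hu0
  have hnew : P (Nat.findGreatest P K + 1) := by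
    refine ⟨Fin.cons (‖u‖⁻¹ • u) v, ?_, ?_⟩
    · rw [orthonormal_iff_ite] at hv ⊢
      intro i j
      refine Fin.cases ?_ (fun i => ?_) i <;> refine Fin.cases ?_ (fun j => ?_) j
      · simp only [Fin.cons_zero, if_true]
        rw [real_inner_self_eq_norm_sq, norm_smul, norm_inv,
          norm_norm, inv_mul_cancel₀ hn.ne', one_pow]
      · rw [Fin.cons_zero, Fin.cons_succ, real_inner_smul_left, real_inner_comm, hu, mul_zero,
          if_neg (Fin.succ_ne_zero j).symm]
      · simp [real_inner_smul_right, hu, Fin.succ_ne_zero i]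
      · simpa using hv i j
    · intro j
      refine Fin.cases ?_ (fun j => ?_) j
      · simp only [Fin.cons_zero, map_smul, norm_smul, norm_inv, norm_norm]
        rwa [lt_inv_mul_iff₀ hn, mul_comm]
      · simpa using hj j
  exact absurd (Nat.le_findGreatest (hP _ hnew) hnew) (by omega)

/-- A version of `exists_orthonormal` with exactly `K` vectors, obtained by padding with zeros. -/
lemma exists_directions (hT : HSNormLE T B) (hB : 0 ≤ B) {τ : ℝ} (hτ : 0 < τ) {K : ℕ}
    (hK : ∀ k : ℕ, k * τ ^ 2 ≤ B ^ 2 → k ≤ K) :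
    ∃ v : Fin K → E, (∀ j, ‖v j‖ ≤ 1) ∧
      (∀ y : Fin K → ℝ, ‖T (∑ j, y j • v j)‖ ^ 2 ≤ B ^ 2 * ∑ j, y j ^ 2) ∧
      ∀ u, ‖T (u - ∑ j, inner ℝ (v j) u • v j)‖ ≤ τ * ‖u‖ := by
  obtain ⟨k, hk, v, hv, hperp⟩ := hT.exists_orthonormal hτ hK
  obtain ⟨l, rfl⟩ := Nat.exists_eq_add_of_le hk
  have hnorm : ∀ y : Fin k → ℝ, ‖∑ j, y j • v j‖ ^ 2 = ∑ j, y j ^ 2 := by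
    intro y
    rw [← real_inner_self_eq_norm_sq, hv.inner_sum]
    simp [sq]
  refine ⟨Fin.append v 0, fun j => ?_, fun y => ?_, fun u => ?_⟩
  · refine Fin.addCases (fun i => ?_) (fun i => ?_) j
    · simp [hv.1 i]
    · simp
  · simp only [Fin.sum_univ_add, Fin.append_left, Fin.append_right, Pi.zero_apply, smul_zero,
      Finset.sum_const_zero, add_zero]
    calc _ ≤ (B * ‖∑ i, y (Fin.castAdd l i) • v i‖) ^ 2 := by
          gcongr; exact hT.norm_apply_le hB _
      _ = B ^ 2 * ∑ i, y (Fin.castAdd l i) ^ 2 := by rw [mul_pow, hnorm]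
      _ ≤ _ := by
        have : 0 ≤ ∑ i, y (Fin.natAdd k i) ^ 2 := Finset.sum_nonneg fun _ _ => sq_nonneg _
        gcongr
        linarith
  · simp only [Fin.sum_univ_add, Fin.append_left, Fin.append_right, Pi.zero_apply, smul_zero,
      Finset.sum_const_zero, add_zero]
    set p := ∑ j, inner ℝ (v j) u • v j with hp
    have horth : ∀ j, inner ℝ (v j) (u - p) = 0 := by
      intro j
      rw [inner_sub_right, hp, hv.inner_right_fintype, sub_self]
    have hpu : inner ℝ p (u - p) = 0 := by
      conv_lhs => rw [hp]
      rw [sum_inner]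
      exact Finset.sum_eq_zero fun j _ => by rw [real_inner_smul_left, horth, mul_zero]
    refine (hperp _ horth).trans ?_
    gcongr
    have h2 : ‖u‖ ^ 2 = ‖p‖ ^ 2 + ‖u - p‖ ^ 2 := by
      have := norm_add_sq_real p (u - p)
      rw [hpu, add_sub_cancel] at this
      linarith
    exact le_of_sq_le_sq (by nlinarith [sq_nonneg ‖p‖]) (norm_nonneg _)

end HSNormLE

end Reduction

/-- The grid point of `[-1, 1]` with index `i`, for the grid of mesh `1 / q`. -/
def gridPoint (q : ℕ) (i : Fin (2 * q + 1)) : ℝ := (i : ℝ) / q - 1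

lemma abs_gridPoint_le {q : ℕ} (hq : 0 < q) (i : Fin (2 * q + 1)) : |gridPoint q i| ≤ 1 := by
  have hq' : (0 : ℝ) < q := by exact_mod_cast hq
  have hi : (i : ℝ) ≤ 2 * q := by exact_mod_cast Nat.lt_succ_iff.1 i.2
  have h1 : (i : ℝ) / q ≤ 2 := by rwa [div_le_iff₀ hq']
  have h2 : 0 ≤ (i : ℝ) / q := by positivity
  rw [gridPoint, abs_le]
  constructor <;> linarith

lemma exists_abs_sub_gridPoint_le {q : ℕ} (hq : 0 < q) {y : ℝ} (hy : |y| ≤ 1) :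
    ∃ i, |y - gridPoint q i| ≤ 1 / q := by
  have hq' : (0 : ℝ) < q := by exact_mod_cast hq
  obtain ⟨h1, h2⟩ := abs_le.1 hy
  have h0 : 0 ≤ (y + 1) * q := mul_nonneg (by linarith) hq'.le
  have hlt : ⌊(y + 1) * q⌋₊ < 2 * q + 1 := by
    rw [Nat.lt_succ_iff]
    refine Nat.floor_le_of_le ?_
    push_cast
    gcongr
    linarith
  refine ⟨⟨_, hlt⟩, ?_⟩
  have ha := Nat.floor_le h0
  have hb := (Nat.lt_floor_add_one ((y + 1) * q)).le
  have : y - gridPoint q ⟨_, hlt⟩ = ((y + 1) * q - ⌊(y + 1) * q⌋₊) / q := by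
    simp only [gridPoint]
    field_simp
    ring
  rw [this, abs_of_nonneg (div_nonneg (by linarith) hq'.le)]
  gcongr
  linarith

/-- A Lipschitz function is approximated on the cube by a finite maximum of quadratics centred
at grid points. -/
lemma abs_sub_sup_grid_le {K q : ℕ} {r Λ : ℝ} (hr : 1 ≤ r) (hΛ : 0 < Λ) (hK : (K : ℝ) ≤ 64 * r ^ 2)
    (hq : 64 * r ^ 2 ≤ q) {g : (Fin K → ℝ) → ℝ}
    (hg : ∀ y z, g y - g z ≤ Λ * √(∑ j, (y j - z j) ^ 2)) {y : Fin K → ℝ} (hy : ∀ j, |y j| ≤ 1) :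
    |g y - Finset.univ.sup' Finset.univ_nonempty (fun z : Fin K → Fin (2 * q + 1) =>
      g (fun j => gridPoint q (z j)) - Λ * r * ∑ j, (y j - gridPoint q (z j)) ^ 2)|
      ≤ Λ / (4 * r) := by
  have hr0 : 0 < r := by linarith
  have hq' : (0 : ℝ) < q := lt_of_lt_of_le (by positivity) hq
  have hq0 : 0 < q := by exact_mod_cast hq'
  rw [abs_sub_le_iff]
  constructor
  · choose z hz using fun j => exists_abs_sub_gridPoint_le hq0 (hy j)
    have hS : ∑ j, (y j - gridPoint q (z j)) ^ 2 ≤ (1 / (8 * r)) ^ 2 := by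
      calc _ ≤ ∑ _j : Fin K, (1 / (q : ℝ)) ^ 2 := by
            refine Finset.sum_le_sum fun j _ => ?_
            rw [← sq_abs]
            gcongr
            exact hz j
        _ = K * (1 / (q : ℝ)) ^ 2 := by simp
        _ ≤ (64 * r ^ 2) * (1 / (64 * r ^ 2)) ^ 2 := by gcongr
        _ = _ := by field_simp; norm_num
    have hS' : √(∑ j, (y j - gridPoint q (z j)) ^ 2) ≤ 1 / (8 * r) :=
      (Real.sqrt_le_sqrt hS).trans_eq (Real.sqrt_sq (by positivity))
    have h1 := Finset.le_sup' (fun z : Fin K → Fin (2 * q + 1) =>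
      g (fun j => gridPoint q (z j)) - Λ * r * ∑ j, (y j - gridPoint q (z j)) ^ 2)
      (Finset.mem_univ z)
    have h2 := hg y (fun j => gridPoint q (z j))
    have h3 : Λ * √(∑ j, (y j - gridPoint q (z j)) ^ 2) ≤ Λ * (1 / (8 * r)) := by gcongr
    have h4 : Λ * r * ∑ j, (y j - gridPoint q (z j)) ^ 2 ≤ Λ * r * (1 / (8 * r)) ^ 2 := by gcongr
    have h5 : Λ * (1 / (8 * r)) + Λ * r * (1 / (8 * r)) ^ 2 ≤ Λ / (4 * r) := by
      have : Λ / (4 * r) - (Λ * (1 / (8 * r)) + Λ * r * (1 / (8 * r)) ^ 2) = 7 * Λ / (64 * r) := by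
        field_simp
        norm_num
      have : 0 ≤ 7 * Λ / (64 * r) := by positivity
      linarith
    linarith
  · rw [sub_le_iff_le_add, Finset.sup'_le_iff]
    intro z _
    set S := ∑ j, (y j - gridPoint q (z j)) ^ 2 with hS
    have hS0 : 0 ≤ S := Finset.sum_nonneg fun _ _ => sq_nonneg _
    have h2 := hg (fun j => gridPoint q (z j)) y
    have h3 : ∑ j, (gridPoint q (z j) - y j) ^ 2 = S :=
      Finset.sum_congr rfl fun j _ => by ring
    rw [h3] at h2
    have h4 : Λ * √S - Λ * r * S ≤ Λ / (4 * r) := by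
      have h5 : Λ / (4 * r) - (Λ * √S - Λ * r * √S ^ 2) = Λ * (2 * r * √S - 1) ^ 2 / (4 * r) := by
        field_simp
        ring
      have h6 : 0 ≤ Λ * (2 * r * √S - 1) ^ 2 / (4 * r) := by positivity
      rw [Real.sq_sqrt hS0] at h5
      linarith
    linarith

section LipschitzComposition

variable {E F Θ : Type*} [NormedAddCommGroup E] [InnerProductSpace ℝ E]
  [NormedAddCommGroup F] [InnerProductSpace ℝ F] {T : Θ → E →ₗ[ℝ] F} {L B r : ℝ} {f : F → ℝ}
  {m : ℕ} {x : Fin m → E}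

/-- One quadratic piece of the approximating maximum. -/
lemma RadLE.quadratic {K q : ℕ} (hx : ∀ i, ‖x i‖ ≤ 1) {v : Θ → Fin K → E}
    (hv : ∀ θ j, ‖v θ j‖ ≤ 1) (hq : 0 < q) (z : Fin K → Fin (2 * q + 1)) {a : Θ → ℝ} {A lam : ℝ}
    (hA : 0 ≤ A) (ha : ∀ θ, |a θ| ≤ A) (hlam : 0 ≤ lam) :
    RadLE (fun θ i => a θ - lam * ∑ j, (inner ℝ (v θ j) (x i) - gridPoint q (z j)) ^ 2)
      ((A + 4 * lam * K) * √m) := by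
  have hone : ∀ j, RadLE (fun θ i => (inner ℝ (v θ j) (x i) - gridPoint q (z j)) ^ 2) (4 * √m) := by
    intro j
    have h1 := ((RadLE.linear (w := fun θ => v θ j) hx zero_le_one
      (fun θ => hv θ j)).const_mul (a := 4) (by norm_num))
    rw [one_mul] at h1
    refine h1.contract fun θ θ' i => ?_
    have hb : ∀ θ, |inner ℝ (v θ j) (x i)| ≤ 1 := fun θ =>
      (abs_real_inner_le_norm _ _).trans (mul_le_one₀ (hv θ j) (norm_nonneg _) (hx i))
    have b1 := abs_le.1 (hb θ)
    have b2 := abs_le.1 (hb θ')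
    have b3 := abs_le.1 (abs_gridPoint_le hq (z j))
    set s := inner ℝ (v θ j) (x i)
    set t := inner ℝ (v θ' j) (x i)
    set w := gridPoint q (z j)
    have e1 : (s - w) ^ 2 - (t - w) ^ 2 = (s + t - 2 * w) * (s - t) := by ring
    have e2 : 4 * s - 4 * t = 4 * (s - t) := by ring
    rw [e1, e2, abs_mul, abs_mul, abs_of_pos (by norm_num : (0 : ℝ) < 4)]
    refine mul_le_mul_of_nonneg_right ?_ (abs_nonneg _)
    rw [abs_le]
    constructor <;> linarith [b1.1, b1.2, b2.1, b2.2, b3.1, b3.2]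
  have hs := ((RadLE.sum Finset.univ fun j _ => hone j).const_mul hlam).neg
  have := (RadLE.const (m := m) hA ha).add hs
  simp only [← sub_eq_add_neg] at this
  refine this.mono (le_of_eq ?_)
  simp
  ring

lemma RadLE.lipschitz_comp (hL : 0 < L) (hB : 0 < B) (hr : 1 ≤ r) (hT : ∀ θ, HSNormLE (T θ) B)
    (hf : ∀ u v, |f u - f v| ≤ L * ‖u - v‖) (hx : ∀ i, ‖x i‖ ≤ 1) {K q : ℕ}
    (hK : K = ⌊64 * r ^ 2⌋₊) (hq : 64 * r ^ 2 ≤ q) :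
    RadLE (fun θ i => f (T θ (x i)))
      ((2 * q + 1) ^ K * (5 * (L * B) * r * K * √m) + m * (L * B / (2 * r))) := by
  have hr0 : 0 < r := by linarith
  have hKr : (K : ℝ) ≤ 64 * r ^ 2 := hK ▸ Nat.floor_le (by positivity)
  have hq0 : 0 < q := by
    have : (0 : ℝ) < q := lt_of_lt_of_le (by positivity) hq
    exact_mod_cast this
  have hτ : 0 < B / (8 * r) := by positivity
  have hcount : ∀ k : ℕ, k * (B / (8 * r)) ^ 2 ≤ B ^ 2 → k ≤ K := by
    intro k hk
    rw [hK]
    refine Nat.le_floor ?_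
    have : (k : ℝ) * (B / (8 * r)) ^ 2 = k / (64 * r ^ 2) * B ^ 2 := by
      field_simp
      norm_num
    rw [this] at hk
    have := le_of_mul_le_mul_right (hk.trans_eq (one_mul _).symm) (by positivity)
    rwa [div_le_one (by positivity)] at this
  choose v hv hvT hvr using fun θ => (hT θ).exists_directions hB.le hτ hcount
  let g : Θ → (Fin K → ℝ) → ℝ := fun θ y => f (T θ (∑ j, y j • v θ j))
  have hnorm : ∀ θ (y : Fin K → ℝ), ‖T θ (∑ j, y j • v θ j)‖ ≤ B * √(∑ j, y j ^ 2) := by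
    intro θ y
    refine le_of_sq_le_sq ?_ (by positivity)
    rw [mul_pow, Real.sq_sqrt (Finset.sum_nonneg fun _ _ => sq_nonneg _)]
    exact hvT θ y
  have hg : ∀ θ y z, g θ y - g θ z ≤ L * B * √(∑ j, (y j - z j) ^ 2) := by
    intro θ y z
    refine (le_abs_self _).trans ((hf _ _).trans ?_)
    rw [← map_sub, ← Finset.sum_sub_distrib, mul_assoc]
    simp only [← sub_smul]
    gcongr
    exact hnorm θ fun j => y j - z j
  have hpiece : ∀ z ∈ (Finset.univ : Finset (Fin K → Fin (2 * q + 1))),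
      RadLE (fun θ i => (g θ (fun j => gridPoint q (z j)) - f 0) - L * B * r *
        ∑ j, (inner ℝ (v θ j) (x i) - gridPoint q (z j)) ^ 2) (5 * (L * B) * r * K * √m) := by
    intro z _
    refine (RadLE.quadratic hx hv hq0 z (A := L * B * K) (by positivity) (fun θ => ?_)
      (by positivity)).mono ?_
    · refine (hf _ _).trans ?_
      rw [sub_zero, mul_assoc]
      gcongr
      refine (hnorm θ _).trans ?_
      gcongr
      have h1 : ∑ j, gridPoint q (z j) ^ 2 ≤ K := by
        calc _ ≤ ∑ _j : Fin K, (1 : ℝ) := Finset.sum_le_sum fun j _ => by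
              rw [← sq_abs]
              exact pow_le_one₀ (abs_nonneg _) (abs_gridPoint_le hq0 _)
          _ = K := by simp
      refine Real.sqrt_le_iff.2 ⟨by positivity, h1.trans ?_⟩
      exact_mod_cast Nat.le_self_pow two_ne_zero K
    · gcongr
      have : L * B * K ≤ L * B * K * r := le_mul_of_one_le_right (by positivity) hr
      nlinarith
  have hmax := (RadLE.sup' Finset.univ_nonempty hpiece).add_const (f 0)
  have happ := hmax.of_abs_sub_le (ψ := fun θ i => f (T θ (x i))) (δ := L * B / (2 * r)) ?_
  · refine happ.mono (le_of_eq ?_)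
    simp
  · intro θ i
    set y : Fin K → ℝ := fun j => inner ℝ (v θ j) (x i) with hy
    have hyb : ∀ j, |y j| ≤ 1 := fun j =>
      (abs_real_inner_le_norm _ _).trans (mul_le_one₀ (hv θ j) (norm_nonneg _) (hx i))
    have h1 := abs_sub_sup_grid_le hr (mul_pos hL hB) hKr hq (hg θ) hyb
    have h2 : |f (T θ (x i)) - g θ y| ≤ L * B / (8 * r) := by
      refine (hf _ _).trans ?_
      rw [← map_sub]
      calc _ ≤ L * (B / (8 * r) * 1) := by
            gcongr
            exact (hvr θ (x i)).trans (by gcongr; exact hx i)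
        _ = _ := by ring
    have h3 : (Finset.univ.sup' Finset.univ_nonempty fun z : Fin K → Fin (2 * q + 1) =>
          (g θ (fun j => gridPoint q (z j)) - f 0) - L * B * r *
            ∑ j, (inner ℝ (v θ j) (x i) - gridPoint q (z j)) ^ 2) + f 0
        = Finset.univ.sup' Finset.univ_nonempty fun z : Fin K → Fin (2 * q + 1) =>
          g θ (fun j => gridPoint q (z j)) - L * B * r * ∑ j, (y j - gridPoint q (z j)) ^ 2 := by
      rw [Finset.sup'_add]
      refine Finset.sup'_congr _ rfl fun z _ => ?_
      simp only [hy]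
      ring
    rw [h3]
    refine (abs_sub_le _ (g θ y) _).trans ((add_le_add h2 h1).trans ?_)
    have : L * B / (2 * r) - (L * B / (8 * r) + L * B / (4 * r)) = L * B / (8 * r) := by
      field_simp
      norm_num
    have : 0 ≤ L * B / (8 * r) := by positivity
    linarith

/-- The trivial bound, without any averaging. -/
lemma RadLE.lipschitz_comp_trivial (hL : 0 < L) (hB : 0 < B) (hT : ∀ θ, HSNormLE (T θ) B)
    (hf : ∀ u v, |f u - f v| ≤ L * ‖u - v‖) (hx : ∀ i, ‖x i‖ ≤ 1) :
    RadLE (fun θ i => f (T θ (x i))) (m * (L * B)) := by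
  have h0 : RadLE (fun (_ : Θ) (_ : Fin m) => f 0) 0 := by
    have : RadLE (fun (_ : Θ) (_ : Fin m) => (0 : ℝ)) 0 := fun θ => by simp
    simpa using this.add_const (f 0)
  rw [← zero_add ((m : ℝ) * _)]
  refine h0.of_abs_sub_le fun θ i => (hf _ _).trans ?_
  rw [sub_zero]
  gcongr
  exact ((hT θ).norm_apply_le hB.le _).trans (mul_le_of_le_one_right hB.le (hx i))

/-- Four-point inequality behind the improved bound for a pair of inputs. -/
lemma four_point_le (hL : 0 < L) (hB : 0 < B) (hT : ∀ θ, HSNormLE (T θ) B)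
    (hf : ∀ u v, |f u - f v| ≤ L * ‖u - v‖) {p q : E} (hp : ‖p‖ ≤ 1) (hq : ‖q‖ ≤ 1)
    (θ₁ θ₂ θ₃ θ₄ : Θ) :
    (f (T θ₁ p) + f (T θ₁ q)) + (-f (T θ₂ p) - f (T θ₂ q)) + (f (T θ₃ p) - f (T θ₃ q))
      + (-f (T θ₄ p) + f (T θ₄ q)) ≤ 7 * (L * B) := by
  have hop := fun θ u => (hT θ).norm_apply_le hB.le u
  have hball : ∀ θ u, ‖u‖ ≤ 1 → ‖T θ u‖ ^ 2 ≤ B ^ 2 := fun θ u hu => by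
    gcongr
    exact (hop θ u).trans (mul_le_of_le_one_right hB.le hu)
  have hlip : ∀ u v, f u - f v ≤ L * ‖u - v‖ := fun u v => (le_abs_self _).trans (hf u v)
  have hdiff : ∀ θ, f (T θ p) - f (T θ q) ≤ L * (B * ‖p - q‖) := fun θ =>
    (hlip _ _).trans (by rw [← map_sub]; gcongr; exact hop θ _)
  have hdiff' : ∀ θ, f (T θ q) - f (T θ p) ≤ L * (B * ‖p - q‖) := fun θ =>
    (hlip _ _).trans (by rw [← map_sub, norm_sub_rev p q]; gcongr; exact hop θ _)
  set a := T θ₁ p with ha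
  set b := T θ₁ q with hb
  set a' := T θ₂ p with ha'
  set b' := T θ₂ q with hb'
  have h1 := hlip a a'
  have h2 := hlip b b'
  have h3 := hlip a b'
  have h4 := hlip b a'
  have hpar : ‖p + q‖ ^ 2 + ‖p - q‖ ^ 2 ≤ 4 := by
    have := parallelogram_law_with_norm ℝ p q
    nlinarith [norm_nonneg p, norm_nonneg q]
  have hcross : -inner ℝ (a + b) (a' + b') ≤ B ^ 2 * ‖p + q‖ ^ 2 := by
    have e1 := neg_le_of_abs_le (abs_real_inner_le_norm (a + b) (a' + b'))
    have e2 : ‖a + b‖ * ‖a' + b'‖ ≤ (B * ‖p + q‖) * (B * ‖p + q‖) := by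
      rw [ha, hb, ha', hb', ← map_add, ← map_add]
      gcongr <;> exact hop _ _
    nlinarith
  have hsq : ‖a - a'‖ ^ 2 + ‖b - b'‖ ^ 2 + ‖a - b'‖ ^ 2 + ‖b - a'‖ ^ 2
      ≤ B ^ 2 * (8 + 2 * ‖p + q‖ ^ 2) := by
    rw [norm_sub_sq_real, norm_sub_sq_real, norm_sub_sq_real, norm_sub_sq_real]
    rw [inner_add_left, inner_add_right, inner_add_right] at hcross
    linarith [hball θ₁ p hp, hball θ₁ q hq, hball θ₂ p hp, hball θ₂ q hq]
  set s := ‖a - a'‖ + ‖b - b'‖ + ‖a - b'‖ + ‖b - a'‖ with hs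
  have hs0 : 0 ≤ s := by positivity
  have hs2 : s ^ 2 ≤ 4 * (B ^ 2 * (8 + 2 * ‖p + q‖ ^ 2)) := by
    refine le_trans ?_ (mul_le_mul_of_nonneg_left hsq (by norm_num))
    nlinarith [sq_nonneg (‖a - a'‖ - ‖b - b'‖), sq_nonneg (‖a - a'‖ - ‖a - b'‖),
      sq_nonneg (‖a - a'‖ - ‖b - a'‖), sq_nonneg (‖b - b'‖ - ‖a - b'‖),
      sq_nonneg (‖b - b'‖ - ‖b - a'‖), sq_nonneg (‖a - b'‖ - ‖b - a'‖)]
  have hfin : s / 2 + 2 * (B * ‖p - q‖) ≤ 7 * B := by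
    refine le_of_sq_le_sq ?_ (by positivity)
    have e1 : (s / 2) ^ 2 + 2 * (B * ‖p - q‖) ^ 2 ≤ 16 * B ^ 2 := by
      have : B ^ 2 * (‖p + q‖ ^ 2 + ‖p - q‖ ^ 2) ≤ B ^ 2 * 4 := by gcongr
      nlinarith
    nlinarith [sq_nonneg (s / 2 - B * ‖p - q‖), sq_nonneg B]
  have hmain : L * (s / 2 + 2 * (B * ‖p - q‖)) ≤ L * (7 * B) := by gcongr
  have hLs : L * s = L * ‖a - a'‖ + L * ‖b - b'‖ + L * ‖a - b'‖ + L * ‖b - a'‖ := by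
    rw [hs]; ring
  linarith [hdiff θ₃, hdiff' θ₄]

lemma sum_pair_le (hL : 0 < L) (hB : 0 < B) (hT : ∀ θ, HSNormLE (T θ) B)
    (hf : ∀ u v, |f u - f v| ≤ L * ‖u - v‖) (hx : ∀ i, ‖x i‖ ≤ 1) {i k : Fin m} (hik : i ≠ k)
    (θ : (Fin m → Bool) → Θ) :
    ∑ e, (boolSign (e i) * f (T (θ e) (x i)) + boolSign (e k) * f (T (θ e) (x k)))
      ≤ 2 ^ m * (7 / 4 * (L * B)) := by
  set G : (Fin m → Bool) → ℝ := fun e =>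
    boolSign (e i) * f (T (θ e) (x i)) + boolSign (e k) * f (T (θ e) (x k)) with hG
  have h1 := sum_flipAt i G
  have h2 := sum_flipAt k G
  have h3 := (sum_flipAt i fun e => G (flipAt k e)).trans h2
  have hpt : ∀ e, G e + G (flipAt i e) + G (flipAt k e) + G (flipAt k (flipAt i e))
      ≤ 7 * (L * B) := by
    intro e
    have four := four_point_le hL hB hT hf (hx i) (hx k)
    simp only [hG, flipAt_same, flipAt_of_ne hik, flipAt_of_ne hik.symm, boolSign_not]
    cases e i <;> cases e k <;> simp only [boolSign_true, boolSign_false]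
    · linarith [four (θ (flipAt k (flipAt i e))) (θ e) (θ (flipAt i e)) (θ (flipAt k e))]
    · linarith [four (θ (flipAt i e)) (θ (flipAt k e)) (θ (flipAt k (flipAt i e))) (θ e)]
    · linarith [four (θ (flipAt k e)) (θ (flipAt i e)) (θ e) (θ (flipAt k (flipAt i e)))]
    · linarith [four (θ e) (θ (flipAt k (flipAt i e))) (θ (flipAt k e)) (θ (flipAt i e))]
  have hsum := Finset.sum_le_sum fun e (_ : e ∈ Finset.univ) => hpt e
  rw [Finset.sum_add_distrib, Finset.sum_add_distrib, Finset.sum_add_distrib, h1, h2, h3,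
    Finset.sum_const, nsmul_eq_mul, card_signs] at hsum
  linarith

/-- With at least two inputs, the trivial bound improves by a constant factor. -/
lemma RadLE.lipschitz_comp_pair (hL : 0 < L) (hB : 0 < B) (hT : ∀ θ, HSNormLE (T θ) B)
    (hf : ∀ u v, |f u - f v| ≤ L * ‖u - v‖) (hx : ∀ i, ‖x i‖ ≤ 1) (hm : 2 ≤ m) :
    RadLE (fun θ i => f (T θ (x i))) (m * (7 / 8 * (L * B))) := by
  obtain ⟨n, rfl⟩ : ∃ n, m = n + 2 := ⟨m - 2, by omega⟩
  intro θ
  have hne : ∀ i : Fin (n + 2), i ≠ finRotate _ i := by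
    intro i h
    rw [finRotate_apply] at h
    simp at h
  have hsum := Finset.sum_le_sum fun i (_ : i ∈ Finset.univ) =>
    sum_pair_le hL hB hT hf hx (hne i) θ
  have hrot : ∀ e : Fin (n + 2) → Bool,
      ∑ i, boolSign (e (finRotate _ i)) * f (T (θ e) (x (finRotate _ i)))
        = ∑ i, boolSign (e i) * f (T (θ e) (x i)) := fun e =>
    Equiv.sum_comp (finRotate (n + 2)) fun i => boolSign (e i) * f (T (θ e) (x i))
  rw [Finset.sum_comm] at hsum
  simp only [Finset.sum_add_distrib, hrot, Finset.sum_const, Finset.card_univ, Fintype.card_fin,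
    nsmul_eq_mul] at hsum
  linarith

end LipschitzComposition

lemma grid_cost_le_sqrt {r : ℝ} (hr : 8 / 7 ≤ r) {m : ℕ} (hm : r ^ (6528 * r ^ 2) ≤ m) :
    (2 * (⌈64 * r ^ 2⌉₊ : ℝ) + 1) ^ ⌊64 * r ^ 2⌋₊ * (10 * r ^ 2 * ⌊64 * r ^ 2⌋₊) ≤ √m := by
  have hr1 : 1 ≤ r := by linarith
  have hr0 : 0 < r := by linarith
  have hr2 : 1 ≤ r ^ 2 := one_le_pow₀ hr1
  have hceil := Nat.ceil_lt_add_one (show 0 ≤ 64 * r ^ 2 by positivity)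
  have hfloor := Nat.floor_le (show 0 ≤ 64 * r ^ 2 by positivity)
  have hbase : 2 * (⌈64 * r ^ 2⌉₊ : ℝ) + 1 ≤ r ^ (50 : ℝ) := by
    calc 2 * (⌈64 * r ^ 2⌉₊ : ℝ) + 1 ≤ 131 * r ^ 2 := by linarith
      _ ≤ (8 / 7) ^ 48 * r ^ 2 := by gcongr; norm_num
      _ ≤ r ^ 48 * r ^ 2 := by gcongr
      _ = r ^ (50 : ℝ) := by rw [← pow_add]; norm_cast
  have hpow : (2 * (⌈64 * r ^ 2⌉₊ : ℝ) + 1) ^ ⌊64 * r ^ 2⌋₊ ≤ r ^ (3200 * r ^ 2) := by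
    calc _ ≤ (r ^ (50 : ℝ)) ^ ⌊64 * r ^ 2⌋₊ := by gcongr
      _ = r ^ (50 * (⌊64 * r ^ 2⌋₊ : ℝ)) := (Real.rpow_mul_natCast hr0.le _ _).symm
      _ ≤ _ := Real.rpow_le_rpow_of_exponent_le hr1 (by linarith)
  have hpoly : 10 * r ^ 2 * (⌊64 * r ^ 2⌋₊ : ℝ) ≤ r ^ (64 * r ^ 2) := by
    calc 10 * r ^ 2 * (⌊64 * r ^ 2⌋₊ : ℝ) ≤ 10 * r ^ 2 * (64 * r ^ 2) := by gcongr
      _ = 640 * r ^ 4 := by ring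
      _ ≤ (8 / 7) ^ 60 * r ^ 4 := by gcongr; norm_num
      _ ≤ r ^ 60 * r ^ 4 := by gcongr
      _ = r ^ (64 : ℝ) := by rw [← pow_add]; norm_cast
      _ ≤ _ := Real.rpow_le_rpow_of_exponent_le hr1 (by linarith)
  refine (mul_le_mul hpow hpoly (by positivity) (by positivity)).trans ?_
  refine Real.le_sqrt_of_sq_le (le_of_eq_of_le ?_ hm)
  rw [← Real.rpow_add hr0, sq, ← Real.rpow_add hr0]
  congr 1
  ring

lemma euclNorm_ofLp {n : ℕ} (u : EuclideanSpace ℝ (Fin n)) : euclNorm (WithLp.ofLp u) = ‖u‖ := by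
  simp [euclNorm, EuclideanSpace.norm_eq]

lemma hsNormLE_toEuclideanLin {n d : ℕ} {W : Matrix (Fin n) (Fin d) ℝ} {B : ℝ}
    (hW : frobNorm W ≤ B) : HSNormLE (Matrix.toEuclideanLin W) B := by
  intro k v hv
  have hentry : ∀ j i, (Matrix.toEuclideanLin W (v j)) i
      = inner ℝ (v j) (WithLp.toLp 2 (W i)) := by
    intro j i
    simp [Matrix.toLpLin_apply, Matrix.mulVec, dotProduct, PiLp.inner_apply]
  calc ∑ j, ‖Matrix.toEuclideanLin W (v j)‖ ^ 2
      = ∑ i, ∑ j, ‖inner ℝ (v j) (WithLp.toLp 2 (W i))‖ ^ 2 := by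
        rw [Finset.sum_comm]
        refine Finset.sum_congr rfl fun j _ => ?_
        rw [EuclideanSpace.norm_sq_eq]
        exact Finset.sum_congr rfl fun i _ => by rw [hentry]
    _ ≤ ∑ i, ‖WithLp.toLp 2 (W i)‖ ^ 2 :=
        Finset.sum_le_sum fun i _ => hv.sum_inner_products_le _
    _ = frobNorm W ^ 2 := by
        rw [frobNorm, Real.sq_sqrt (by positivity)]
        exact Finset.sum_congr rfl fun i _ => by simp [EuclideanSpace.norm_sq_eq]
    _ ≤ B ^ 2 := by
        have : 0 ≤ frobNorm W := Real.sqrt_nonneg _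
        gcongr

lemma radComplexity_le_of_radLE {n d m : ℕ} {f : (Fin n → ℝ) → ℝ} {B : ℝ} (hB : 0 ≤ B) (hm : 0 < m)
    {x : Fin m → Fin d → ℝ} {ε : ℝ}
    (h : RadLE (fun (W : {W : Matrix (Fin n) (Fin d) ℝ // frobNorm W ≤ B}) i =>
      f (W.1.mulVec (x i))) (m * ε)) :
    radComplexity {h : (Fin d → ℝ) → ℝ | ∃ W : Matrix (Fin n) (Fin d) ℝ,
      frobNorm W ≤ B ∧ h = fun z => f (W.mulVec z)} x ≤ ε := by
  have hm' : (0 : ℝ) < m := by exact_mod_cast hm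
  refine le_of_forall_pos_le_add fun δ hδ => ?_
  rw [radComplexity, div_le_iff₀ (by positivity)]
  have hsel : ∀ e : Fin m → Bool, ∃ W : {W : Matrix (Fin n) (Fin d) ℝ // frobNorm W ≤ B},
      sSup ((fun f => (∑ i, (if e i then (1 : ℝ) else -1) * f (x i)) / (m : ℝ)) ''
        {h : (Fin d → ℝ) → ℝ | ∃ W : Matrix (Fin n) (Fin d) ℝ,
          frobNorm W ≤ B ∧ h = fun z => f (W.mulVec z)})
        ≤ (∑ i, boolSign (e i) * f (W.1.mulVec (x i))) / m + δ := by
    intro e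
    obtain ⟨_, ⟨_, ⟨W, hW, rfl⟩, rfl⟩, hlt⟩ := exists_lt_of_lt_csSup
      (Set.Nonempty.image (fun f => (∑ i, (if e i then (1 : ℝ) else -1) * f (x i)) / (m : ℝ))
        (s := {h : (Fin d → ℝ) → ℝ | ∃ W : Matrix (Fin n) (Fin d) ℝ,
          frobNorm W ≤ B ∧ h = fun z => f (W.mulVec z)})
        ⟨_, 0, by simpa [frobNorm] using hB, rfl⟩) (sub_lt_self _ hδ)
    exact ⟨⟨W, hW⟩, (sub_lt_iff_lt_add.1 hlt).le⟩
  choose W hW using hsel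
  refine (Finset.sum_le_sum fun e _ => hW e).trans ?_
  rw [Finset.sum_add_distrib, ← Finset.sum_div, Finset.sum_const, nsmul_eq_mul, card_signs]
  have := (div_le_iff₀ hm').2 ((h W).trans_eq (by ring : _ = 2 ^ m * ε * m))
  linarith

/-- Corollary: for a fixed `L`-Lipschitz `f : ℝ^n → ℝ`, if `m ≥ (LB/ε)^(c L² B² / ε²)`
then the Rademacher complexity of `{x ↦ f(Wx) : ‖W‖_F ≤ B}` on `m` inputs from the
Euclidean unit ball is at most `ε`. -/
theorem statement2 :
    ∃ c : ℝ, 0 < c ∧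
      ∀ (L B ε : ℝ) (n d m : ℕ) (f : (Fin n → ℝ) → ℝ),
        1 ≤ L → 1 ≤ B → 0 < ε → ε ≤ 1 → 1 ≤ L * B / ε →
        (∀ u v : Fin n → ℝ, |f u - f v| ≤ L * euclNorm (u - v)) →
        (L * B / ε) ^ (c * L ^ 2 * B ^ 2 / ε ^ 2) ≤ (m : ℝ) →
        ∀ x : Fin m → (Fin d → ℝ), (∀ i, euclNorm (x i) ≤ 1) →
          radComplexity
            {h : (Fin d → ℝ) → ℝ |
              ∃ W : Matrix (Fin n) (Fin d) ℝ,
                frobNorm W ≤ B ∧ h = fun z => f (W.mulVec z)} x ≤ ε := by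
  refine ⟨6528, by norm_num, ?_⟩
  intro L B ε n d m f hL hB hε _ hr hf hm x hx
  have hL0 : 0 < L := by linarith
  have hB0 : 0 < B := by linarith
  have hexp : 6528 * L ^ 2 * B ^ 2 / ε ^ 2 = 6528 * (L * B / ε) ^ 2 := by
    rw [div_pow]
    ring
  have hεr : ε = L * B / (L * B / ε) := by field_simp
  rw [hexp] at hm
  have hm1 : (1 : ℝ) ≤ m := (Real.one_le_rpow hr (by positivity)).trans hm
  have hm0 : 0 < m := by exact_mod_cast (zero_lt_one.trans_le hm1)
  refine radComplexity_le_of_radLE hB0.le hm0 ?_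
  have hT : ∀ W : {W : Matrix (Fin n) (Fin d) ℝ // frobNorm W ≤ B},
      HSNormLE (Matrix.toEuclideanLin W.1) B := fun W => hsNormLE_toEuclideanLin W.2
  have hf' : ∀ u v : EuclideanSpace ℝ (Fin n),
      |f (WithLp.ofLp u) - f (WithLp.ofLp v)| ≤ L * ‖u - v‖ := fun u v => by
    rw [← euclNorm_ofLp]
    exact hf _ _
  have hx' : ∀ i, ‖WithLp.toLp 2 (x i)‖ ≤ 1 := fun i => by
    rw [← euclNorm_ofLp]
    exact hx i
  set r := L * B / ε with hrdef
  change RadLE (fun (W : {W : Matrix (Fin n) (Fin d) ℝ // frobNorm W ≤ B}) i =>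
    f (WithLp.ofLp (Matrix.toEuclideanLin W.1 (WithLp.toLp 2 (x i))))) (m * ε)
  rcases hr.eq_or_lt with h1 | h1
  · rw [hεr, ← h1, div_one]
    exact RadLE.lipschitz_comp_trivial (f := fun u => f (WithLp.ofLp u)) hL0 hB0 hT hf' hx'
  have hr0 : 0 < r := by linarith
  rcases le_total r (8 / 7) with h2 | h2
  · have hm2 : 2 ≤ m := by
      have : (1 : ℝ) < m := (Real.one_lt_rpow h1 (by positivity)).trans_le hm
      exact_mod_cast this
    refine (RadLE.lipschitz_comp_pair (f := fun u => f (WithLp.ofLp u)) hL0 hB0 hT hf' hx'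
      hm2).mono ?_
    rw [hεr]
    gcongr
    rw [le_div_iff₀ hr0]
    have : L * B * r ≤ L * B * (8 / 7) := by gcongr
    linarith
  · refine (RadLE.lipschitz_comp (f := fun u => f (WithLp.ofLp u)) hL0 hB0 hr hT hf' hx'
      rfl (Nat.le_ceil _)).mono ?_
    have hs : √(m : ℝ) * √m = m := Real.mul_self_sqrt (Nat.cast_nonneg m)
    have hN := grid_cost_le_sqrt h2 hm
    have h3 : (2 * (⌈64 * r ^ 2⌉₊ : ℝ) + 1) ^ ⌊64 * r ^ 2⌋₊ *
        (5 * (L * B) * r * ⌊64 * r ^ 2⌋₊ * √m) ≤ m * (L * B / (2 * r)) := by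
      calc _ = ((2 * (⌈64 * r ^ 2⌉₊ : ℝ) + 1) ^ ⌊64 * r ^ 2⌋₊ *
            (10 * r ^ 2 * ⌊64 * r ^ 2⌋₊)) * √m * (L * B / (2 * r)) := by
            field_simp
            ring
        _ ≤ √m * √m * (L * B / (2 * r)) := by gcongr
        _ = _ := by rw [hs]
    have h4 : (m : ℝ) * ε = m * (L * B / (2 * r)) + m * (L * B / (2 * r)) := by
      rw [hεr]
      field_simp
      norm_num
    linarith
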